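/- Let G be a nontrivial group (i.e. G contains an element different from the identity). Then the triadic action of S₃ on G × G × G is faithful: no element of S₃ other than the identity permutation acts as the identity map of G × G × G. -/

import Mathlib

/-- Every permutation of three letters is a word in the rotation and a transposition. -/
theorem perm_fin_three_eq : ∀ σ : Equiv.Perm (Fin 3),
    σ = 1 ∨ σ = finRotate 3 ∨ σ = finRotate 3 * finRotate 3 ∨ σ = Equiv.swap 0 1 ∨
      σ = finRotate 3 * Equiv.swap 0 1 ∨ σ = finRotate 3 * (finRotate 3 * Equiv.swap 0 1) := by
  decide


/-- Let `G` be a nontrivial group. Then the triadic action of `S₃` on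
`G × G × G` — the action (homomorphism `φ : S₃ → Perm (G × G × G)`) in which the 3-cycle
`(123)` acts by `r (g₁,g₂,g₃) = (g₃,g₁,g₂)` and the transposition `(12)` acts by
`s (g₁,g₂,g₃) = (g₂⁻¹,g₁⁻¹,g₃⁻¹)` — is faithful: no element of `S₃` other than the identity
acts as the identity map, i.e. `φ` is injective. -/
theorem triadic_action_faithful (G : Type*) [Group G] (hG : ∃ g : G, g ≠ 1)
    (r s : G × G × G → G × G × G)
    (hr : ∀ g₁ g₂ g₃ : G, r (g₁, g₂, g₃) = (g₃, g₁, g₂))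
    (hs : ∀ g₁ g₂ g₃ : G, s (g₁, g₂, g₃) = (g₂⁻¹, g₁⁻¹, g₃⁻¹))
    (φ : Equiv.Perm (Fin 3) →* Equiv.Perm (G × G × G))
    (hφr : ⇑(φ (finRotate 3)) = r) (hφs : ⇑(φ (Equiv.swap 0 1)) = s) :
    Function.Injective φ := by
  obtain ⟨g, hg⟩ := hG
  subst hφr hφs
  rw [injective_iff_map_eq_one]
  intro σ hσ
  have h₁ := DFunLike.congr_fun hσ (g, 1, 1)
  have h₂ := DFunLike.congr_fun hσ (1, g, 1)
  rcases perm_fin_three_eq σ with rfl | rfl | rfl | rfl | rfl | rfl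
  · rfl
  all_goals simp [hr, hs, hg, Ne.symm hg] at h₁ h₂
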